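/- Let u be an infinite word over a finite alphabet whose language is closed under reversal. Then for all n ∈ ℕ, the palindromic complexity and factor complexity of u satisfy P(n+1) + P(n) ≤ C(n+1) − C(n) + 2. -/

import Mathlib

open List

/-- The factor of `u` of length `n` starting at position `i`. -/
def word {A : Type*} (u : ℕ → A) (i n : ℕ) : List A :=
  (List.range n).map (fun j => u (i + j))

/-- `w` occurs in `u` at position `i`. -/
def OccursAt {A : Type*} (u : ℕ → A) (w : List A) (i : ℕ) : Prop :=
  w = word u i w.length

/-- `w` is a factor of the infinite word `u`. -/
def IsFactor {A : Type*} (u : ℕ → A) (w : List A) : Prop :=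
  ∃ i, OccursAt u w i

/-- Every letter of the alphabet occurs in `u`. -/
def AllLettersOccur {A : Type*} (u : ℕ → A) : Prop :=
  ∀ a : A, ∃ i, u i = a

/-- The language of `u` is closed under reversal. -/
def ClosedUnderReversal {A : Type*} (u : ℕ → A) : Prop :=
  ∀ w : List A, IsFactor u w → IsFactor u w.reverse

/-- `u` is uniformly recurrent: every factor occurs in every window of some
bounded length. -/
def UniformlyRecurrent {A : Type*} (u : ℕ → A) : Prop :=
  ∀ w : List A, IsFactor u w → ∃ N : ℕ, ∀ i : ℕ, ∃ j : ℕ,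
    i ≤ j ∧ j < i + N ∧ OccursAt u w j

/-- Factor complexity: the number of factors of `u` of length `n`. -/
noncomputable def complexity {A : Type*} (u : ℕ → A) (n : ℕ) : ℕ :=
  Set.ncard {w : List A | w.length = n ∧ IsFactor u w}

/-- Palindromic complexity: the number of palindromic factors of `u` of
length `n`. -/
noncomputable def palComplexity {A : Type*} (u : ℕ → A) (n : ℕ) : ℕ :=
  Set.ncard {w : List A | w.length = n ∧ IsFactor u w ∧ w.reverse = w}

/-- The number of distinct palindromic factors of a finite word
(the empty word included). -/
noncomputable def palCount {A : Type*} (w : List A) : ℕ :=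
  Set.ncard {v : List A | v <:+: w ∧ v.reverse = v}

/-- `u` is rich in palindromes. -/
def Rich {A : Type*} (u : ℕ → A) : Prop :=
  ∀ w : List A, IsFactor u w → palCount w = w.length + 1

/-- `j < k` are two successive occurrences of `w` in `u`. -/
def SuccOccurrences {A : Type*} (u : ℕ → A) (w : List A) (j k : ℕ) : Prop :=
  OccursAt u w j ∧ OccursAt u w k ∧ j < k ∧
    ∀ l : ℕ, j < l → l < k → ¬ OccursAt u w l

/-- The set of return words of the factor `w` in `u`. -/
def returnWords {A : Type*} (u : ℕ → A) (w : List A) : Set (List A) :=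
  {v | ∃ j k : ℕ, SuccOccurrences u w j k ∧ v = word u j (k - j)}

/-- Left extensions of `w` in `u`. -/
def Lext {A : Type*} (u : ℕ → A) (w : List A) : Set A :=
  {a | IsFactor u (a :: w)}

/-- Right extensions of `w` in `u`. -/
def Rext {A : Type*} (u : ℕ → A) (w : List A) : Set A :=
  {b | IsFactor u (w ++ [b])}

/-- Bilateral extensions of `w` in `u`. -/
def Bext {A : Type*} (u : ℕ → A) (w : List A) : Set (A × A) :=
  {p | IsFactor u (p.1 :: (w ++ [p.2]))}

/-- Palindromic extensions of a (palindromic) factor `w` of `u`. -/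
def Pext {A : Type*} (u : ℕ → A) (w : List A) : Set (List A) :=
  {v | ∃ a : A, v = a :: (w ++ [a]) ∧ IsFactor u v}

/-- `w` is a bispecial factor of `u`. -/
def Bispecial {A : Type*} (u : ℕ → A) (w : List A) : Prop :=
  IsFactor u w ∧ 2 ≤ Set.ncard (Lext u w) ∧ 2 ≤ Set.ncard (Rext u w)

/-- The bilateral order of a factor `w` of `u`. -/
noncomputable def bilateralOrder {A : Type*} (u : ℕ → A) (w : List A) : ℤ :=
  (Set.ncard (Bext u w) : ℤ) - Set.ncard (Rext u w) - Set.ncard (Lext u w) + 1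

/-- `u` is eventually periodic. -/
def EventuallyPeriodic {A : Type*} (u : ℕ → A) : Prop :=
  ∃ p : ℕ, 0 < p ∧ ∃ N : ℕ, ∀ n : ℕ, N ≤ n → u (n + p) = u n

/-- `u` is aperiodic. -/
def Aperiodic {A : Type*} (u : ℕ → A) : Prop :=
  ¬ EventuallyPeriodic u

/-- `u` is (1-)balanced. -/
def IsBalanced {A : Type*} [DecidableEq A] (u : ℕ → A) : Prop :=
  ∀ a : A, ∀ w v : List A, IsFactor u w → IsFactor u v → w.length = v.length →
    |(w.count a : ℤ) - (v.count a : ℤ)| ≤ 1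

theorem word_length' {A : Type*} (u : ℕ → A) (i n : ℕ) : (word u i n).length = n := by
  simp [word]

theorem word_isFactor {A : Type*} (u : ℕ → A) (i n : ℕ) : IsFactor u (word u i n) :=
  ⟨i, by simp [OccursAt, word_length']⟩

theorem word_take {A : Type*} (u : ℕ → A) (i n : ℕ) :
    (word u i (n + 1)).take n = word u i n := by
  simp [word, List.range_succ]

theorem word_drop {A : Type*} (u : ℕ → A) (i n : ℕ) :
    (word u i (n + 1)).drop 1 = word u (i + 1) n := by
  simp only [word, List.range_succ_eq_map, List.map_cons, List.map_map, List.drop_succ_cons,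
    List.drop_zero]
  apply List.map_congr_left
  intro j _
  simp only [Function.comp]
  congr 1
  omega

theorem rev_take {A : Type*} (e : List A) (n : ℕ) (h : e.length = n + 1) :
    e.reverse.take n = (e.drop 1).reverse := by
  rw [List.take_reverse]; congr 2; omega

theorem rev_drop {A : Type*} (e : List A) (n : ℕ) (h : e.length = n + 1) :
    e.reverse.drop 1 = (e.take n).reverse := by
  rw [List.drop_reverse]; congr 2; omega

open Classical in
theorem weight_insert {A : Type*} (V : Finset (List A)) (w : List A) :
    (insert w (insert w.reverse V)).card +
      ((insert w (insert w.reverse V)).filter (fun v => v.reverse = v)).card ≤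
    V.card + (V.filter (fun v => v.reverse = v)).card + 2 := by
  by_cases hp : w.reverse = w
  · rw [hp, Finset.insert_idem, Finset.filter_insert, if_pos hp]
    have h1 := Finset.card_insert_le w V
    have h2 := Finset.card_insert_le w (V.filter (fun v => v.reverse = v))
    omega
  · have hp' : ¬ w.reverse.reverse = w.reverse := by
      rw [List.reverse_reverse]; exact fun h => hp h.symm
    rw [Finset.filter_insert, if_neg hp, Finset.filter_insert, if_neg hp']
    have h1 := Finset.card_insert_le w (insert w.reverse V)
    have h2 := Finset.card_insert_le w.reverse V
    omega

open Classical in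
theorem explore {A : Type*} (u : ℕ → A) (hcur : ClosedUnderReversal u) (n t : ℕ) :
    ∃ V E : Finset (List A), (∀ i ≤ t, word u i n ∈ V) ∧ (∀ v ∈ V, v.reverse ∈ V) ∧
      (∀ e ∈ E, e.length = n + 1 ∧ IsFactor u e ∧ e.reverse ≠ e ∧ e.take n ∈ V ∧
        e.drop 1 ∈ V) ∧
      V.card + (V.filter (fun v => v.reverse = v)).card ≤ E.card + 2 := by
  induction t with
  | zero =>
    refine ⟨insert (word u 0 n) (insert (word u 0 n).reverse ∅), ∅, ?_, ?_, ?_, ?_⟩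
    · intro i hi
      obtain rfl : i = 0 := by omega
      simp
    · intro v hv
      simp at hv
      rcases hv with rfl | rfl <;> simp
    · simp
    · simpa using weight_insert ∅ (word u 0 n)
  | succ t ih =>
    obtain ⟨V, E, h1, h2, h3, h4⟩ := ih
    by_cases hv : word u (t + 1) n ∈ V
    · refine ⟨V, E, ?_, h2, h3, h4⟩
      intro i hi
      rcases Nat.lt_or_ge t i with h | h
      · obtain rfl : i = t + 1 := by omega
        exact hv
      · exact h1 i h
    · have hl := word_length' u t (n + 1)
      have hf := word_isFactor u t (n + 1)
      have ht := word_take u t n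
      have hd := word_drop u t n
      have hw := h1 t le_rfl
      generalize word u t (n + 1) = e at hl hf ht hd
      have hrt := rev_take e n hl
      have hrd := rev_drop e n hl
      rw [hd] at hrt
      rw [ht] at hrd
      have hvr : (word u (t + 1) n).reverse ∉ V := by
        intro h
        have := h2 _ h
        rw [List.reverse_reverse] at this
        exact hv this
      have hne : e.reverse ≠ e := by
        intro h
        rw [h, ht] at hrt
        exact hvr (hrt ▸ hw)
      have he : e ∉ E := fun h => hv (hd ▸ (h3 e h).2.2.2.2)
      have her : e.reverse ∉ E := fun h => hvr (hrt ▸ (h3 _ h).2.2.2.1)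
      refine ⟨insert (word u (t + 1) n) (insert (word u (t + 1) n).reverse V),
        insert e (insert e.reverse E), ?_, ?_, ?_, ?_⟩
      · intro i hi
        rcases Nat.lt_or_ge t i with h | h
        · obtain rfl : i = t + 1 := by omega
          simp
        · simp [h1 i h]
      · intro v hv
        simp only [Finset.mem_insert] at hv
        rcases hv with rfl | rfl | hv
        · simp
        · simp
        · simp [h2 v hv]
      · intro f hfE
        simp only [Finset.mem_insert] at hfE
        rcases hfE with rfl | rfl | hfE
        · refine ⟨hl, hf, hne, ?_, ?_⟩
          · rw [ht]; simp [hw]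
          · rw [hd]; simp
        · refine ⟨by simpa using hl, hcur _ hf, ?_, ?_, ?_⟩
          · rw [List.reverse_reverse]; exact hne.symm
          · rw [hrt]; simp
          · rw [hrd]; simp [h2 _ hw]
        · obtain ⟨a, b, c, d, g⟩ := h3 f hfE
          exact ⟨a, b, c, by simp [d], Finset.mem_insert_of_mem (Finset.mem_insert_of_mem g)⟩
      · have hc := weight_insert V (word u (t + 1) n)
        rw [Finset.card_insert_of_notMem (a := e), Finset.card_insert_of_notMem her]
        · omega
        · simp only [Finset.mem_insert, not_or]
          exact ⟨hne.symm, he⟩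

theorem factors_finite {A : Type*} [Fintype A] (u : ℕ → A) (n : ℕ) :
    {w : List A | w.length = n ∧ IsFactor u w}.Finite :=
  (List.finite_length_eq A n).subset fun _ h => h.1

theorem exists_bound {A : Type*} [Fintype A] (u : ℕ → A) (n : ℕ) :
    ∃ T, ∀ w : List A, w.length = n → IsFactor u w → ∃ i ≤ T, w = word u i n := by
  have hfin := factors_finite u n
  have h : ∀ w : List A, ∃ i, (w.length = n ∧ IsFactor u w) → w = word u i n := by
    intro w
    by_cases h : w.length = n ∧ IsFactor u w
    · obtain ⟨hl, i, hi⟩ := h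
      refine ⟨i, fun _ => ?_⟩
      rw [OccursAt, hl] at hi
      exact hi
    · exact ⟨0, fun h' => absurd h' h⟩
  choose f hf using h
  refine ⟨hfin.toFinset.sup f, fun w hl hw => ⟨f w, ?_, hf w ⟨hl, hw⟩⟩⟩
  exact Finset.le_sup (f := f) (by simpa using ⟨hl, hw⟩)

/-- If the language of `u` is closed under reversal, then
`P(n+1) + P(n) ≤ C(n+1) − C(n) + 2` for all `n`. -/
theorem stmt1 {A : Type*} [Fintype A] (u : ℕ → A)
    (hall : AllLettersOccur u)
    (hcur : ClosedUnderReversal u) :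
    ∀ n : ℕ, (palComplexity u (n + 1) : ℤ) + (palComplexity u n : ℤ) ≤
      (complexity u (n + 1) : ℤ) - (complexity u n : ℤ) + 2 := by
  classical
  intro n
  obtain ⟨T, hT⟩ := exists_bound u n
  obtain ⟨V, E, h1, h2, h3, h4⟩ := explore u hcur n T
  have hV : ∀ w : List A, w.length = n → IsFactor u w → w ∈ V := by
    intro w hl hw
    obtain ⟨i, hi, rfl⟩ := hT w hl hw
    exact h1 i hi
  have hC : complexity u n ≤ V.card := by
    rw [complexity, ← Set.ncard_coe_finset]
    exact Set.ncard_le_ncard (fun w hw => hV w hw.1 hw.2) V.finite_toSet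
  have hP : palComplexity u n ≤ (V.filter (fun v => v.reverse = v)).card := by
    rw [palComplexity, ← Set.ncard_coe_finset]
    refine Set.ncard_le_ncard (fun w hw => ?_) (Finset.finite_toSet _)
    simp only [Finset.coe_filter, Set.mem_setOf_eq]
    exact ⟨hV w hw.1 hw.2.1, hw.2.2⟩
  have hE : E.card + palComplexity u (n + 1) ≤ complexity u (n + 1) := by
    rw [palComplexity, complexity, ← Set.ncard_coe_finset, ← Set.ncard_union_eq ?_
      E.finite_toSet ((factors_finite u (n + 1)).subset fun w hw => ⟨hw.1, hw.2.1⟩)]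
    · refine Set.ncard_le_ncard ?_ (factors_finite u (n + 1))
      rintro w (hw | hw)
      · exact ⟨(h3 w hw).1, (h3 w hw).2.1⟩
      · exact ⟨hw.1, hw.2.1⟩
    · rw [Set.disjoint_left]
      exact fun w hw hw' => (h3 w hw).2.2.1 hw'.2.2
  omega
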